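/- arXiv:quant-ph/9905077 — 6 statements merged into one kernel-verified Lean document; each statement's English description precedes it below -/
import Mathlib

section
/- The simplices associated to permutations partition the box: B = ⋃_{σ ∈ Perm(Fin n)} S σ, and for distinct permutations σ ≠ τ the interiors are disjoint, interior(S σ) ∩ interior(S τ) = ∅. -/
/-- The simplex spanned by the partial sums of the edge vectors of a box with side lengths `c`,
taken in the order `σ`, consists of the points of the box whose rescaled coordinates decrease
along `σ`. -/
theorem mem_convexHull_partialSums_iff {n : ℕ} {c : Fin n → ℝ} (hc : ∀ j, 0 < c j)
    (σ : Equiv.Perm (Fin n)) {v : ℕ → EuclideanSpace ℝ (Fin n)}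
    (hv : ∀ m k, v m (σ k) = if (k : ℕ) < m then c (σ k) else 0)
    (x : EuclideanSpace ℝ (Fin n)) :
    x ∈ convexHull ℝ {y | ∃ m, m ≤ n ∧ y = v m} ↔
      (∀ j, 0 ≤ x j ∧ x j ≤ c j) ∧ Antitone fun k => x (σ k) / c (σ k) := by
  constructor
  · have hconv : Convex ℝ {x : EuclideanSpace ℝ (Fin n) |
        (∀ j, 0 ≤ x j ∧ x j ≤ c j) ∧ Antitone fun k => x (σ k) / c (σ k)} := by
      rintro x ⟨hx, hx'⟩ y ⟨hy, hy'⟩ a b ha hb hab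
      refine ⟨fun j => ?_, fun i j hij => ?_⟩
      · obtain ⟨hx0, hx1⟩ := hx j
        obtain ⟨hy0, hy1⟩ := hy j
        simp only [PiLp.add_apply, PiLp.smul_apply, smul_eq_mul]
        refine ⟨by positivity, ?_⟩
        calc a * x j + b * y j ≤ a * c j + b * c j := by gcongr
          _ = c j := by rw [← add_mul, hab, one_mul]
      · have h1 := mul_le_mul_of_nonneg_left (hx' hij) ha
        have h2 := mul_le_mul_of_nonneg_left (hy' hij) hb
        simp only [PiLp.add_apply, PiLp.smul_apply, smul_eq_mul, add_div, mul_div_assoc] at h1 h2 ⊢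
        exact add_le_add h1 h2
    refine fun hx => convexHull_min ?_ hconv hx
    rintro _ ⟨m, -, rfl⟩
    refine ⟨fun j => ?_, fun i j hij => ?_⟩
    · obtain ⟨k, rfl⟩ := σ.surjective j
      rw [hv]
      have := (hc (σ k)).le
      split_ifs <;> simp [this]
    · have hij' : (i : ℕ) ≤ j := hij
      have hi := (hc (σ i)).ne'
      have hj := (hc (σ j)).ne'
      simp only [hv]
      split_ifs
      · simp [hi, hj]
      · omega
      · simp [hi]
      · simp
  · rintro ⟨hx, hanti⟩
    let u : ℕ → ℝ := fun m =>
      if m = 0 then 1 else if h : m - 1 < n then x (σ ⟨m - 1, h⟩) / c (σ ⟨m - 1, h⟩) else 0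
    have hu_zero : u 0 = 1 := by simp [u]
    have hu_succ (k : Fin n) : u (k + 1) = x (σ k) / c (σ k) := by simp [u]
    have hu_last : u (n + 1) = 0 := by simp [u]
    have hu_le (m : ℕ) (hm : m ≤ n) : u (m + 1) ≤ u m := by
      rcases hm.lt_or_eq with hm | rfl
      · rw [hu_succ ⟨m, hm⟩]
        rcases m with _ | m
        · rw [hu_zero]
          exact (div_le_one (hc _)).2 (hx _).2
        · rw [hu_succ ⟨m, by omega⟩]
          exact hanti (by simp [Fin.le_def])
      · rw [hu_last]
        rcases m with _ | m
        · simp [hu_zero]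
        · rw [hu_succ ⟨m, by omega⟩]
          exact div_nonneg (hx _).1 (hc _).le
    have hsum_eq : ∑ m ∈ Finset.range (n + 1), (u m - u (m + 1)) • v m = x := by
      ext i
      obtain ⟨k, rfl⟩ := σ.surjective i
      have hfilter : (Finset.range (n + 1)).filter (fun m => (k : ℕ) < m)
          = Finset.Ico ((k : ℕ) + 1) (n + 1) := by
        ext m
        simp only [Finset.mem_filter, Finset.mem_range, Finset.mem_Ico]
        omega
      have htel : ∑ m ∈ Finset.Ico ((k : ℕ) + 1) (n + 1), (u m - u (m + 1))
          = u (k + 1) - u (n + 1) := by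
        have := Finset.sum_Ico_sub u (show (k : ℕ) + 1 ≤ n + 1 by omega)
        rw [← neg_inj, ← Finset.sum_neg_distrib]
        simpa using this
      simp only [WithLp.ofLp_sum, Finset.sum_apply, PiLp.smul_apply, smul_eq_mul, hv, mul_ite,
        mul_zero]
      rw [← Finset.sum_filter, hfilter, ← Finset.sum_mul, htel, hu_succ, hu_last, sub_zero,
        div_mul_cancel₀ _ (hc _).ne']
    rw [← hsum_eq]
    refine (convex_convexHull ℝ _).sum_mem (fun m hm => ?_) ?_ (fun m hm => ?_)
    · exact sub_nonneg.2 (hu_le m (by simpa [Nat.lt_succ_iff] using hm))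
    · rw [Finset.sum_range_sub', hu_zero, hu_last, sub_zero]
    · exact subset_convexHull ℝ _ ⟨m, by simpa [Nat.lt_succ_iff] using hm, rfl⟩

/-- Two distinct permutations of `Fin n` order some pair of values differently. -/
theorem Equiv.Perm.exists_lt_symm_lt_of_ne {n : ℕ} {σ τ : Equiv.Perm (Fin n)} (h : σ ≠ τ) :
    ∃ i j, i < j ∧ τ.symm (σ j) < τ.symm (σ i) := by
  by_contra! hle
  have hmono : StrictMono (τ.symm ∘ σ) := fun i j hij =>
    (hle i j hij).lt_of_ne fun he => hij.ne (σ.injective (τ.symm.injective he))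
  have hid : τ.symm ∘ σ = id := (hmono.range_inj strictMono_id).1 <| by
    rw [(τ.symm.surjective.comp σ.surjective).range_eq, Set.range_id]
  exact h (Equiv.ext fun i => τ.symm_apply_eq.1 (congrFun hid i))

/-- A set of points with proportional `i`-th and `j`-th coordinates has empty interior. -/
theorem interior_eq_empty_of_div_eq_div {n : ℕ} {c : Fin n → ℝ} (hc : ∀ j, 0 < c j)
    {i j : Fin n} (hij : i ≠ j) {T : Set (EuclideanSpace ℝ (Fin n))}
    (hT : ∀ x ∈ T, x i / c i = x j / c j) : interior T = ∅ := by
  refine Set.eq_empty_iff_forall_notMem.2 fun x hx => ?_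
  have hcont : Filter.Tendsto (fun t : ℝ => x + t • EuclideanSpace.single i (1 : ℝ))
      (nhds 0) (nhds x) := by
    have : Continuous fun t : ℝ => x + t • EuclideanSpace.single i (1 : ℝ) := by fun_prop
    simpa using this.tendsto 0
  have hev : ∀ᶠ t in nhds (0 : ℝ), x + t • EuclideanSpace.single i (1 : ℝ) ∈ T :=
    hcont (mem_interior_iff_mem_nhds.1 hx)
  obtain ⟨t, ht, ht0⟩ := ((hev.filter_mono nhdsWithin_le_nhds).and
    (self_mem_nhdsWithin (s := Set.Ioi (0 : ℝ)))).exists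
  have h0 := hT x (interior_subset hx)
  have h1 := hT _ ht
  have hpos : 0 < t / c i := div_pos ht0 (hc i)
  simp [hij.symm, add_div] at h1
  linarith


/-- The simplices `S σ` associated to permutations partition the box `B`:
their union is `B` and distinct simplices have disjoint interiors. -/
theorem simplices_partition_box
    (n : ℕ) (hn : 1 ≤ n) (r : Fin n → ℝ)
    (hr : ∀ j, 0 < r j) (hsum : ∑ j, (r j) ^ 2 = 1)
    (f : Fin n → EuclideanSpace ℝ (Fin n))
    (hf : ∀ j, f j = EuclideanSpace.single j (2 * Real.pi * r j))
    (B : Set (EuclideanSpace ℝ (Fin n)))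
    (hB : B = {x | ∀ j, 0 ≤ x j ∧ x j ≤ 2 * Real.pi * r j})
    (w : Equiv.Perm (Fin n) → ℕ → EuclideanSpace ℝ (Fin n))
    (hw : ∀ σ m, w σ m = ∑ ν ∈ Finset.univ.filter (fun ν : Fin n => (ν : ℕ) < m), f (σ ν))
    (S : Equiv.Perm (Fin n) → Set (EuclideanSpace ℝ (Fin n)))
    (hS : ∀ σ, S σ = convexHull ℝ {y | ∃ m, m ≤ n ∧ y = w σ m}) :
    (B = ⋃ σ : Equiv.Perm (Fin n), S σ) ∧
    (∀ σ τ : Equiv.Perm (Fin n), σ ≠ τ →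
      interior (S σ) ∩ interior (S τ) = ∅) := by
  have hc (j : Fin n) : 0 < 2 * Real.pi * r j := mul_pos Real.two_pi_pos (hr j)
  have hmem (σ : Equiv.Perm (Fin n)) (x : EuclideanSpace ℝ (Fin n)) :=
    mem_convexHull_partialSums_iff hc σ (v := w σ) (fun m k => by
      simp [hw, hf, Pi.single_apply, Finset.sum_ite_eq]) x
  simp only [← hS] at hmem
  refine ⟨?_, fun σ τ hne => ?_⟩
  · ext x
    simp only [hB, Set.mem_ofPred_eq, Set.mem_iUnion, hmem]
    refine ⟨fun hx => ?_, fun ⟨_, hx, _⟩ => hx⟩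
    refine ⟨Tuple.sort fun j => -(x j / (2 * Real.pi * r j)), hx, fun i j hij => ?_⟩
    exact neg_le_neg_iff.1 (Tuple.monotone_sort (fun j => -(x j / (2 * Real.pi * r j))) hij)
  · obtain ⟨i, j, hij, hji⟩ := Equiv.Perm.exists_lt_symm_lt_of_ne hne
    rw [← interior_inter]
    refine interior_eq_empty_of_div_eq_div hc (σ.injective.ne hij.ne) fun x hx => ?_
    have h1 := ((hmem σ x).1 hx.1).2 hij.le
    have h2 := ((hmem τ x).1 hx.2).2 hji.le
    simp only [Equiv.apply_symm_apply] at h1 h2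
    exact le_antisymm h2 h1
end

section
/- Every diagonal coset meets every part of the Pythagorean partition: for every x ∈ ℝ^n and every k : Fin n there exist t ∈ ℝ and ℓ ∈ L such that x + t·s + ℓ ∈ A k. (Equivalently, every coset of the diagonal subgroup Δ = ϖ({t·s | t ∈ ℝ}) in ℝ^n ⧸ L intersects p k = ϖ(A k).) -/
/-- Every diagonal coset meets every part of the Pythagorean partition:
for every `x` and every `k` there are `t : ℝ` and a lattice vector `ℓ ∈ L` with
`x + t • s + ℓ ∈ A k`. -/
theorem diagonal_cosets_meet_every_part
    (n : ℕ) (hn : 1 ≤ n) (r : Fin n → ℝ)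
    (hr : ∀ j, 0 < r j) (hsum : ∑ j, (r j) ^ 2 = 1)
    (f : Fin n → EuclideanSpace ℝ (Fin n))
    (hf : ∀ j, f j = EuclideanSpace.single j (2 * Real.pi * r j))
    (s : EuclideanSpace ℝ (Fin n)) (hs : s = ∑ j, f j)
    (g : Fin n → EuclideanSpace ℝ (Fin n))
    (hg : ∀ j, g j = (r j) ^ 2 • s - f j)
    (A : Fin n → Set (EuclideanSpace ℝ (Fin n)))
    (hA : ∀ k, A k = {y | ∃ c : ℝ, ∃ d : Fin n → ℝ,
      c ∈ Set.Icc (0:ℝ) 1 ∧ (∀ j, d j ∈ Set.Icc (0:ℝ) 1) ∧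
      y = c • ((r k) ^ 2 • s) + ∑ j ∈ Finset.univ.erase k, d j • g j})
    (L : AddSubgroup (EuclideanSpace ℝ (Fin n)))
    (hL : L = AddSubgroup.closure (Set.range f)) :
    ∀ x : EuclideanSpace ℝ (Fin n), ∀ k : Fin n,
      ∃ t : ℝ, ∃ ℓ : EuclideanSpace ℝ (Fin n), ℓ ∈ L ∧ x + t • s + ℓ ∈ A k := by
  intro x k
  have hx : x = ∑ j, (x j / (2 * Real.pi * r j)) • f j := by
    ext i
    have h0 := (hr i).ne'
    simp [hf, Pi.single_apply]
    field_simp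
  set a : Fin n → ℝ := fun j ↦ x j / (2 * Real.pi * r j)
  set m : Fin n → ℤ := fun j ↦ ⌈a j - a k⌉
  set d : Fin n → ℝ := fun j ↦ m j - (a j - a k) with hd
  have hdk : d k = 0 := by simp [hd, m]
  refine ⟨-a k + ∑ j, d j * r j ^ 2, -∑ j, m j • f j, ?_, ?_⟩
  · rw [hL]
    exact neg_mem (sum_mem fun j _ ↦
      zsmul_mem (AddSubgroup.subset_closure (Set.mem_range_self j)) _)
  · rw [hA]
    refine ⟨0, d, by simp, fun j ↦ ⟨sub_nonneg.2 (Int.le_ceil _), ?_⟩, ?_⟩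
    · have := Int.ceil_lt_add_one (a j - a k)
      simp only [hd, m]
      linarith
    · have h : ∑ j, d j • f j = ∑ j, m j • f j - x + a k • s := by
        rw [hx, hs, Finset.smul_sum, ← Finset.sum_sub_distrib, ← Finset.sum_add_distrib]
        refine Finset.sum_congr rfl fun j _ ↦ ?_
        rw [← Int.cast_smul_eq_zsmul ℝ]
        simp only [hd]
        module
      rw [Finset.sum_erase _ (by rw [hdk, zero_smul])]
      simp only [hg, smul_sub, Finset.sum_sub_distrib, h, smul_smul, ← Finset.sum_smul]
      module
end

section
/- Every line parallel to the diagonal meets the interior of A k either trivially or in a segment of length exactly 2π·(r k)²: for every x ∈ ℝ^n and every k : Fin n, the set {t ∈ ℝ | x + t·s ∈ interior(A k)} is either empty or equal to the open interval (a, a + (r k)²) for some a ∈ ℝ. (Since ‖s‖ = 2π, a t-interval of length (r k)² corresponds to arclength 2π·(r k)².) -/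
/-- The coordinates of a vector with respect to the diagonal `s = (2π r j)_j` (in position `k`)
and the vectors `(r j)² s - f j`, `j ≠ k`, where `f j = 2π (r j) e j`. -/
noncomputable def diagonalCoord {n : ℕ} (r : Fin n → ℝ) (k : Fin n) :
    EuclideanSpace ℝ (Fin n) →ₗ[ℝ] (Fin n → ℝ) where
  toFun y i := if i = k then ∑ j, r j ^ 2 * (y j / (2 * Real.pi * r j))
    else y k / (2 * Real.pi * r k) - y i / (2 * Real.pi * r i)
  map_add' y z := by
    ext i
    by_cases h : i = k
    · simp [h, add_div, mul_add, Finset.sum_add_distrib]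
    · simp only [h, if_false, PiLp.add_apply, Pi.add_apply]
      ring
  map_smul' c y := by
    ext i
    by_cases h : i = k
    · simp only [h, if_true, PiLp.smul_apply, Pi.smul_apply, smul_eq_mul, RingHom.id_apply,
        Finset.mul_sum]
      exact Finset.sum_congr rfl fun j _ => by ring
    · simp only [h, if_false, PiLp.smul_apply, Pi.smul_apply, smul_eq_mul, RingHom.id_apply]
      ring

section diagonalCoord

variable {n : ℕ} {r : Fin n → ℝ}

theorem diagonalCoord_apply_self (k : Fin n) (y : EuclideanSpace ℝ (Fin n)) :
    diagonalCoord r k y k = ∑ j, r j ^ 2 * (y j / (2 * Real.pi * r j)) := by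
  simp [diagonalCoord]

theorem diagonalCoord_apply_of_ne {k i : Fin n} (h : i ≠ k) (y : EuclideanSpace ℝ (Fin n)) :
    diagonalCoord r k y i = y k / (2 * Real.pi * r k) - y i / (2 * Real.pi * r i) := by
  simp [diagonalCoord, h]

theorem diagonalCoord_injective (hr : ∀ j, 0 < r j) (hsum : ∑ j, r j ^ 2 = 1) (k : Fin n) :
    Function.Injective (diagonalCoord r k) := by
  rw [← LinearMap.ker_eq_bot, LinearMap.ker_eq_bot']
  intro y hy
  have hu (i : Fin n) : y i / (2 * Real.pi * r i) = y k / (2 * Real.pi * r k) := by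
    by_cases h : i = k
    · rw [h]
    · have := congrFun hy i
      rw [diagonalCoord_apply_of_ne h, Pi.zero_apply] at this
      linarith
  have hk := congrFun hy k
  simp only [diagonalCoord_apply_self, hu, ← Finset.sum_mul, hsum, one_mul, Pi.zero_apply] at hk
  ext i
  have hi := (hu i).trans hk
  have hpos : 2 * Real.pi * r i ≠ 0 := by have := hr i; positivity
  simpa [hpos] using (div_eq_zero_iff.1 hi)

theorem diagonalCoord_single (hr : ∀ j, 0 < r j) (k j : Fin n) :
    diagonalCoord r k (EuclideanSpace.single j (2 * Real.pi * r j)) =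
      fun i => if i = k then r j ^ 2 else (if k = j then 1 else 0) - (if i = j then 1 else 0) := by
  have hu (i : Fin n) : (EuclideanSpace.single j (2 * Real.pi * r j) : EuclideanSpace ℝ (Fin n)) i /
      (2 * Real.pi * r i) = if i = j then 1 else 0 := by
    have hpos : 2 * Real.pi * r i ≠ 0 := by have := hr i; positivity
    by_cases h : i = j
    · subst h; simp [div_self hpos]
    · simp [h]
  ext i
  by_cases h : i = k
  · simp only [h, diagonalCoord_apply_self, hu]
    simp
  · simp only [h, diagonalCoord_apply_of_ne h, hu, if_false]

theorem diagonalCoord_diagonal (hr : ∀ j, 0 < r j) (hsum : ∑ j, r j ^ 2 = 1) (k : Fin n) :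
    diagonalCoord r k (∑ j, EuclideanSpace.single j (2 * Real.pi * r j)) = Pi.single k 1 := by
  ext i
  by_cases h : i = k
  · simp [h, map_sum, diagonalCoord_single hr, hsum]
  · simp [h, map_sum, diagonalCoord_single hr]

theorem diagonalCoord_combination (hr : ∀ j, 0 < r j) {k : Fin n}
    {s : EuclideanSpace ℝ (Fin n)} (hs : diagonalCoord r k s = Pi.single k 1)
    (a : ℝ) (d : Fin n → ℝ) :
    diagonalCoord r k (a • s + ∑ j ∈ Finset.univ.erase k,
      d j • (r j ^ 2 • s - EuclideanSpace.single j (2 * Real.pi * r j))) =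
      Function.update d k a := by
  have hg (j : Fin n) (hj : j ∈ Finset.univ.erase k) : diagonalCoord r k (d j • (r j ^ 2 • s -
      EuclideanSpace.single j (2 * Real.pi * r j))) = Pi.single j (d j) := by
    have hjk := Finset.ne_of_mem_erase hj
    ext i
    by_cases h : i = k
    · subst h
      simp [hs, diagonalCoord_single hr, hjk.symm]
    · simp [hs, diagonalCoord_single hr, h, hjk.symm, Pi.single_apply]
  rw [map_add, map_smul, hs, map_sum, Finset.sum_congr rfl hg]
  ext i
  by_cases h : i = k
  · subst h
    simp [Finset.sum_apply, Pi.single_apply]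
  · simp [Finset.sum_apply, Pi.single_apply, h]

end diagonalCoord

/-- Every line parallel to the diagonal meets the interior of `A k`
either trivially or in an open segment of parameter length exactly `(r k)²`
(i.e. arclength `2π (r k)²` since `‖s‖ = 2π`). -/
theorem diagonal_lines_meet_interior_in_uniform_segments
    (n : ℕ) (hn : 1 ≤ n) (r : Fin n → ℝ)
    (hr : ∀ j, 0 < r j) (hsum : ∑ j, (r j) ^ 2 = 1)
    (f : Fin n → EuclideanSpace ℝ (Fin n))
    (hf : ∀ j, f j = EuclideanSpace.single j (2 * Real.pi * r j))
    (s : EuclideanSpace ℝ (Fin n)) (hs : s = ∑ j, f j)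
    (g : Fin n → EuclideanSpace ℝ (Fin n))
    (hg : ∀ j, g j = (r j) ^ 2 • s - f j)
    (A : Fin n → Set (EuclideanSpace ℝ (Fin n)))
    (hA : ∀ k, A k = {y | ∃ c : ℝ, ∃ d : Fin n → ℝ,
      c ∈ Set.Icc (0:ℝ) 1 ∧ (∀ j, d j ∈ Set.Icc (0:ℝ) 1) ∧
      y = c • ((r k) ^ 2 • s) + ∑ j ∈ Finset.univ.erase k, d j • g j}) :
    ∀ x : EuclideanSpace ℝ (Fin n), ∀ k : Fin n,
      ({t : ℝ | x + t • s ∈ interior (A k)} = ∅) ∨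
      (∃ a : ℝ, {t : ℝ | x + t • s ∈ interior (A k)} = Set.Ioo a (a + (r k) ^ 2)) := by
  intro x k
  obtain rfl : f = fun j => EuclideanSpace.single j (2 * Real.pi * r j) := funext hf
  have hLs : diagonalCoord r k s = Pi.single k 1 := hs ▸ diagonalCoord_diagonal hr hsum k
  have hcomb := diagonalCoord_combination hr hLs
  set L := diagonalCoord r k
  have hrk : 0 < r k ^ 2 := pow_pos (hr k) 2
  have hsurj : Function.Surjective L := fun d => ⟨_, by rw [hcomb (d k) d, Function.update_eq_self]⟩
  set B : Fin n → ℝ := Function.update 1 k (r k ^ 2) with hB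
  have hAk : A k = L ⁻¹' Set.univ.pi fun i => Set.Icc 0 (B i) := by
    ext y
    simp only [hA, hg, Set.mem_ofPred_eq, Set.mem_preimage, Set.mem_univ_pi]
    constructor
    · rintro ⟨c, d, hc, hd, rfl⟩ i
      rw [smul_smul, hcomb]
      by_cases h : i = k
      · subst h
        simpa [hB] using ⟨mul_nonneg hc.1 hrk.le, mul_le_of_le_one_left hrk.le hc.2⟩
      · simpa [hB, h] using hd i
    · intro hy
      have hyk := hy k
      simp only [hB, Function.update_self] at hyk
      refine ⟨L y k / r k ^ 2, Function.update (L y) k 0,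
        ⟨div_nonneg hyk.1 hrk.le, (div_le_one hrk).2 hyk.2⟩, fun j => ?_, ?_⟩
      · by_cases h : j = k
        · simp [h]
        · simpa [hB, h] using hy j
      · apply diagonalCoord_injective hr hsum k
        rw [smul_smul, hcomb, div_mul_cancel₀ _ hrk.ne', Function.update_idem,
          Function.update_eq_self]
  have hint (y : EuclideanSpace ℝ (Fin n)) :
      y ∈ interior (A k) ↔ ∀ i, L y i ∈ Set.Ioo 0 (B i) := by
    rw [hAk, ← (L.isOpenMap_of_finiteDimensional hsurj).preimage_interior_eq_interior_preimage
      L.continuous_of_finiteDimensional, interior_pi_set Set.finite_univ]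
    simp
  by_cases hx : ∀ i, i ≠ k → L x i ∈ Set.Ioo (0 : ℝ) 1
  · refine Or.inr ⟨-L x k, Set.ext fun t => ?_⟩
    rw [Set.mem_ofPred_eq, hint]
    constructor
    · intro h
      have := h k
      simp only [map_add, map_smul, hLs, hB, Pi.add_apply, Pi.smul_apply, Pi.single_eq_same,
        smul_eq_mul, mul_one, Function.update_self, Set.mem_Ioo] at this
      constructor <;> linarith
    · rintro ⟨h1, h2⟩ i
      by_cases h : i = k
      · subst h
        simp only [map_add, map_smul, hLs, hB, Pi.add_apply, Pi.smul_apply, Pi.single_eq_same,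
          smul_eq_mul, mul_one, Function.update_self, Set.mem_Ioo]
        constructor <;> linarith
      · simpa [hLs, hB, h] using hx i h
  · refine Or.inl (Set.eq_empty_iff_forall_notMem.2 fun t ht => hx fun i h => ?_)
    simpa [hLs, hB, h] using (hint _).1 ht i
end

section
/- Each part of the Pythagorean partition contains the corresponding generating circle: for every k : Fin n, the closed segment from 0 to f k is contained in A k, and the open segment from 0 to f k is contained in interior(A k). (Under the quotient map ϖ this says the k-th bouquet circle C k lies in p k = ϖ(A k), and C k minus its basepoint lies in the image of the interior.) -/
/-- Each part of the Pythagorean partition contains the corresponding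
generating circle: the closed segment from `0` to `f k` lies in `A k`, and the open
segment lies in `interior (A k)`. -/
theorem bouquet_circle_in_part
    (n : ℕ) (hn : 1 ≤ n) (r : Fin n → ℝ)
    (hr : ∀ j, 0 < r j) (hsum : ∑ j, (r j) ^ 2 = 1)
    (f : Fin n → EuclideanSpace ℝ (Fin n))
    (hf : ∀ j, f j = EuclideanSpace.single j (2 * Real.pi * r j))
    (s : EuclideanSpace ℝ (Fin n)) (hs : s = ∑ j, f j)
    (g : Fin n → EuclideanSpace ℝ (Fin n))
    (hg : ∀ j, g j = (r j) ^ 2 • s - f j)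
    (A : Fin n → Set (EuclideanSpace ℝ (Fin n)))
    (hA : ∀ k, A k = {y | ∃ c : ℝ, ∃ d : Fin n → ℝ,
      c ∈ Set.Icc (0:ℝ) 1 ∧ (∀ j, d j ∈ Set.Icc (0:ℝ) 1) ∧
      y = c • ((r k) ^ 2 • s) + ∑ j ∈ Finset.univ.erase k, d j • g j}) :
    ∀ k : Fin n,
      segment ℝ 0 (f k) ⊆ A k ∧
      openSegment ℝ 0 (f k) ⊆ interior (A k) := by
  intro k
  have hπ : (2 * Real.pi) ≠ 0 := by positivity
  have hr0 : ∀ j, r j ≠ 0 := fun j => (hr j).ne'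
  have hf_apply : ∀ j i, f j i = if i = j then 2 * Real.pi * r j else 0 := by
    intro j i
    simp [hf]
  have hs_apply : ∀ i, s i = 2 * Real.pi * r i := by
    intro i
    simp [hs, hf_apply]
  -- the coordinates of a vector in the basis f
  let u : EuclideanSpace ℝ (Fin n) → Fin n → ℝ := fun y i => y i / (2 * Real.pi * r i)
  let c : EuclideanSpace ℝ (Fin n) → ℝ := fun y => (∑ j, u y j * r j ^ 2) / r k ^ 2
  have mem_A : ∀ y, c y ∈ Set.Icc (0 : ℝ) 1 →
      (∀ j, j ≠ k → u y k - u y j ∈ Set.Icc (0 : ℝ) 1) → y ∈ A k := by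
    intro y hc hd
    rw [hA]
    refine ⟨c y, fun j => u y k - u y j, hc, fun j => ?_, ?_⟩
    · by_cases hj : j = k
      · simp [hj]
      · exact hd j hj
    · rw [Finset.sum_erase _ (by simp)]
      ext i
      have hc_mul : c y * r k ^ 2 = ∑ j, u y j * r j ^ 2 :=
        div_mul_cancel₀ _ (pow_ne_zero 2 (hr0 k))
      have hd_sum : ∑ j, (u y k - u y j) * r j ^ 2 = u y k - ∑ j, u y j * r j ^ 2 := by
        simp only [sub_mul, Finset.sum_sub_distrib]
        rw [← Finset.mul_sum, hsum, mul_one]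
      have hg_sum : ∑ j, (u y k - u y j) * g j i =
          (∑ j, (u y k - u y j) * r j ^ 2) * (2 * Real.pi * r i) -
            (u y k - u y i) * (2 * Real.pi * r i) := by
        simp [hg, hs_apply, hf_apply, mul_sub, Finset.sum_mul, mul_assoc]
      have hu : u y i * (2 * Real.pi * r i) = y i :=
        div_mul_cancel₀ _ (mul_ne_zero hπ (hr0 i))
      simp only [PiLp.add_apply, PiLp.smul_apply, WithLp.ofLp_sum, Finset.sum_apply,
        smul_eq_mul, hs_apply]
      rw [hg_sum, hd_sum, ← mul_assoc, hc_mul, ← hu]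
      ring
  have hu_smul : ∀ t j, u (t • f k) j = if j = k then t else 0 := by
    intro t j
    by_cases hj : j = k
    · subst hj
      simpa [u, hf_apply] using mul_div_cancel_right₀ t (mul_ne_zero hπ (hr0 j))
    · simp [u, hf_apply, hj]
  have hc_smul : ∀ t, c (t • f k) = t := by
    intro t
    simp [c, hu_smul, hr0]
  have hu_cont : ∀ j, Continuous fun y => u y j := by
    intro j
    fun_prop
  have hc_cont : Continuous c := by
    fun_prop
  constructor
  · rw [segment_eq_image]
    rintro _ ⟨t, ht, rfl⟩
    simp only [smul_zero, zero_add]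
    refine mem_A _ (by rwa [hc_smul]) fun j hj => ?_
    simpa [hu_smul, hj] using ht
  · have hopen : IsOpen {y | c y ∈ Set.Ioo (0 : ℝ) 1 ∧
        ∀ j, j ≠ k → u y k - u y j ∈ Set.Ioo (0 : ℝ) 1} := by
      simp only [Set.ofPred_and, Set.ofPred_forall]
      exact (isOpen_Ioo.preimage hc_cont).inter <| isOpen_iInter_of_finite fun j =>
        isOpen_iInter_of_finite fun _ => isOpen_Ioo.preimage ((hu_cont k).sub (hu_cont j))
    refine Set.Subset.trans ?_ (interior_maximal (fun y hy => mem_A y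
      (Set.Ioo_subset_Icc_self hy.1) fun j hj => Set.Ioo_subset_Icc_self (hy.2 j hj)) hopen)
    rw [openSegment_eq_image]
    rintro _ ⟨t, ht, rfl⟩
    simp only [smul_zero, zero_add]
    refine ⟨by rwa [hc_smul], fun j hj => ?_⟩
    simpa [hu_smul, hj] using ht
end

section
/- For every k : Fin n, the intersection of A k with the diagonal line through the origin is the segment from 0 to (r k)²·s: A k ∩ {t·s | t ∈ ℝ} = segment ℝ 0 ((r k)²·s). -/
/-- The intersection of the parallelotope `A k` with the diagonal line
through the origin is the segment from `0` to `(r k)² • s`. -/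
theorem part_meets_main_diagonal_in_segment
    (n : ℕ) (hn : 1 ≤ n) (r : Fin n → ℝ)
    (hr : ∀ j, 0 < r j) (hsum : ∑ j, (r j) ^ 2 = 1)
    (f : Fin n → EuclideanSpace ℝ (Fin n))
    (hf : ∀ j, f j = EuclideanSpace.single j (2 * Real.pi * r j))
    (s : EuclideanSpace ℝ (Fin n)) (hs : s = ∑ j, f j)
    (g : Fin n → EuclideanSpace ℝ (Fin n))
    (hg : ∀ j, g j = (r j) ^ 2 • s - f j)
    (A : Fin n → Set (EuclideanSpace ℝ (Fin n)))
    (hA : ∀ k, A k = {y | ∃ c : ℝ, ∃ d : Fin n → ℝ,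
      c ∈ Set.Icc (0:ℝ) 1 ∧ (∀ j, d j ∈ Set.Icc (0:ℝ) 1) ∧
      y = c • ((r k) ^ 2 • s) + ∑ j ∈ Finset.univ.erase k, d j • g j}) :
    ∀ k : Fin n,
      A k ∩ {y | ∃ t : ℝ, y = t • s} = segment ℝ 0 ((r k) ^ 2 • s) := by
  intro k
  have hs_apply : ∀ i, s i = 2 * Real.pi * r i := fun i => by
    simp [hs, hf, Pi.single_apply]
  have hs_ne : ∀ i, s i ≠ 0 := fun i => by
    rw [hs_apply]
    have := hr i
    positivity
  have hg_apply : ∀ j i, g j i = (r j ^ 2 - if i = j then 1 else 0) * s i := fun j i => by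
    by_cases h : i = j
    · subst h
      simp [hg, hf, hs_apply]
      ring
    · simp [hg, hf, h]
  rw [segment_eq_image]
  ext y
  simp only [hA, Set.mem_inter_iff, Set.mem_ofPred_eq, Set.mem_image, smul_zero, zero_add]
  constructor
  · rintro ⟨⟨c, d, hc, -, hy⟩, t, ht⟩
    refine ⟨c, hc, ?_⟩
    have key : ∀ i, t = c * r k ^ 2 +
        ∑ j ∈ Finset.univ.erase k, d j * (r j ^ 2 - if i = j then 1 else 0) := fun i => by
      have h := congrArg (fun v : EuclideanSpace ℝ (Fin n) => v i) (ht.symm.trans hy)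
      simp only [PiLp.smul_apply, PiLp.add_apply, WithLp.ofLp_sum, Finset.sum_apply,
        smul_eq_mul, hg_apply] at h
      apply mul_right_cancel₀ (hs_ne i)
      rw [h, add_mul, Finset.sum_mul]
      simp only [mul_assoc]
    simp only [mul_sub, Finset.sum_sub_distrib, mul_ite, mul_one, mul_zero,
      Finset.sum_ite_eq, Finset.mem_erase, Finset.mem_univ, and_true] at key
    have hk := key k
    have hd : ∀ j ∈ Finset.univ.erase k, d j = 0 := fun j hj => by
      have hj' := key j
      rw [if_pos (Finset.ne_of_mem_erase hj)] at hj'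
      simp only [ne_eq, not_true_eq_false, if_false] at hk
      linarith
    rw [hy, Finset.sum_eq_zero fun j hj => by rw [hd j hj, zero_smul], add_zero]
  · rintro ⟨c, hc, rfl⟩
    exact ⟨⟨c, 0, hc, by simp, by simp⟩, c * r k ^ 2, smul_smul _ _ _⟩
end

section
/- A natural assignment of a pure state to a regular mixed state must pick a spectral (eigen)projection: let ρ : Matrix (Fin n) (Fin n) ℂ be Hermitian with an orthonormal eigenbasis φ : Fin n → EuclideanSpace ℂ (Fin n), ρ.mulVec (φ j) = (x j)·(φ j), whose eigenvalues x j are pairwise distinct. Let γ : Matrix (Fin n) (Fin n) ℂ be a rank-one orthogonal projection (γ·γ = γ, γᴴ = γ, trace γ = 1) such that every unitary matrix U commuting with ρ (U·ρ = ρ·U) also commutes with γ (U·γ = γ·U). Then γ is one of the eigenprojections of ρ: there exists j with γ = |φ j⟩⟨φ j|, i.e. γ = Matrix.vecMulVec (φ j) (star ∘ (φ j)). -/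
open Matrix

theorem exists_eq_single_of_mul_self_of_sum_eq_one {ι : Type*} [Fintype ι] [DecidableEq ι]
    {g : ι → ℂ} (hg : ∀ k, g k * g k = g k) (hsum : ∑ k, g k = 1) :
    ∃ j, g = Pi.single j 1 := by
  have h01 : ∀ k, g k = 0 ∨ g k = 1 := fun k ↦ by
    exact IsIdempotentElem.iff_eq_zero_or_one.mp (hg k)
  obtain ⟨j, -, hj⟩ : ∃ j ∈ Finset.univ, g j ≠ 0 :=
    Finset.exists_ne_zero_of_sum_ne_zero (by simp [hsum])
  have hj1 : g j = 1 := (h01 j).resolve_left hj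
  have hrest : ∑ k ∈ Finset.univ.erase j, (g k).re = 0 := by
    have h := Finset.add_sum_erase Finset.univ g (Finset.mem_univ j)
    rw [hsum, hj1, add_eq_left] at h
    simpa using congrArg Complex.re h
  rw [Finset.sum_eq_zero_iff_of_nonneg
    (fun k _ ↦ by rcases h01 k with h | h <;> simp [h])] at hrest
  refine ⟨j, funext fun k ↦ ?_⟩
  rcases eq_or_ne k j with rfl | hk
  · simpa using hj1
  · rw [Pi.single_eq_of_ne hk]
    refine (h01 k).resolve_right fun h ↦ ?_
    simpa [h] using hrest k (by simp [hk])

theorem eq_diagonal_of_forall_commute_sign {ι : Type*} [Fintype ι] [DecidableEq ι]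
    {G : Matrix ι ι ℂ}
    (hG : ∀ d : ι → ℂ, (∀ k, d k = 1 ∨ d k = -1) → diagonal d * G = G * diagonal d) :
    G = diagonal G.diag := by
  ext a b
  rcases eq_or_ne a b with rfl | hab
  · simp
  · have h := congrFun₂ (hG (fun k ↦ if k = a then -1 else 1) fun k ↦ by
      by_cases hk : k = a <;> simp [hk]) a b
    rw [diagonal_mul, mul_diagonal, if_pos rfl, if_neg hab.symm] at h
    rw [diagonal_apply_ne _ hab]
    linear_combination (-1 / 2 : ℂ) * h

/-- A rank-one orthogonal projection commuting with every unitary that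
commutes with a Hermitian matrix `ρ` having pairwise distinct eigenvalues must be one
of the eigenprojections of `ρ`. -/
theorem natural_pure_state_is_spectral_projection
    (n : ℕ) (hn : 1 ≤ n)
    (ρ : Matrix (Fin n) (Fin n) ℂ) (hherm : ρ.IsHermitian)
    (x : Fin n → ℝ)
    (φ : Fin n → EuclideanSpace ℂ (Fin n))
    (hON : Orthonormal ℂ φ)
    (heig : ∀ j : Fin n, ρ.mulVec (fun a => φ j a) = fun a => (x j : ℂ) * φ j a)
    (hdist : ∀ j k : Fin n, j ≠ k → x j ≠ x k)
    (γ : Matrix (Fin n) (Fin n) ℂ)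
    (hidem : γ * γ = γ) (hsa : γᴴ = γ) (htr : γ.trace = 1)
    (hcomm : ∀ U : Matrix (Fin n) (Fin n) ℂ,
      U * Uᴴ = 1 → Uᴴ * U = 1 → U * ρ = ρ * U → U * γ = γ * U) :
    ∃ j : Fin n, γ = Matrix.vecMulVec (fun a => φ j a) (star ∘ fun a => φ j a) := by
  set V : Matrix (Fin n) (Fin n) ℂ := of fun a j ↦ φ j a with hV
  have hVV : Vᴴ * V = 1 := by
    ext i j
    have h := orthonormal_iff_ite.mp hON i j
    rw [PiLp.inner_apply] at h
    simpa [mul_apply, hV, one_apply, mul_comm] using h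
  have hVV' : V * Vᴴ = 1 := mul_eq_one_comm.mp hVV
  have hρV : ρ * V = V * diagonal fun k ↦ (x k : ℂ) := by
    ext a j
    rw [mul_diagonal, mul_comm]
    exact congrFun (heig j) a
  have hρ : ρ = V * (diagonal fun k ↦ (x k : ℂ)) * Vᴴ := by
    rw [← hρV, mul_assoc, hVV', mul_one]
  have conj_mul (A B : Matrix (Fin n) (Fin n) ℂ) :
      V * A * Vᴴ * (V * B * Vᴴ) = V * (A * B) * Vᴴ := by
    rw [show V * A * Vᴴ * (V * B * Vᴴ) = V * A * (Vᴴ * V) * B * Vᴴ by simp only [mul_assoc],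
      hVV, mul_one, mul_assoc V A B]
  have conj_inj {A B : Matrix (Fin n) (Fin n) ℂ} (h : V * A * Vᴴ = V * B * Vᴴ) : A = B := by
    have cancel (C : Matrix (Fin n) (Fin n) ℂ) : Vᴴ * (V * C * Vᴴ) * V = C := by
      rw [show Vᴴ * (V * C * Vᴴ) * V = Vᴴ * V * C * (Vᴴ * V) by simp only [mul_assoc],
        hVV, mul_one, one_mul]
    rw [← cancel A, h, cancel]
  obtain ⟨G, rfl⟩ : ∃ G, γ = V * G * Vᴴ := ⟨Vᴴ * γ * V, by
    rw [show V * (Vᴴ * γ * V) * Vᴴ = V * Vᴴ * γ * (V * Vᴴ) by simp only [mul_assoc],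
      hVV', mul_one, one_mul]⟩
  have hdiag : G = diagonal G.diag := by
    refine eq_diagonal_of_forall_commute_sign fun d hd ↦ conj_inj ?_
    have hdd : diagonal d * diagonal d = 1 := by
      rw [diagonal_mul_diagonal, ← diagonal_one]
      congr 1
      funext k
      rcases hd k with h | h <;> simp [h]
    have hUH : (V * diagonal d * Vᴴ)ᴴ = V * diagonal d * Vᴴ := by
      have hstar : star d = d := by
        funext k
        rcases hd k with h | h <;> simp [h]
      rw [conjTranspose_mul, conjTranspose_mul, conjTranspose_conjTranspose,
        diagonal_conjTranspose, hstar, mul_assoc]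
    have hUU : V * diagonal d * Vᴴ * (V * diagonal d * Vᴴ) = 1 := by
      rw [conj_mul, hdd, mul_one, hVV']
    rw [← conj_mul, ← conj_mul]
    refine hcomm _ (by rw [hUH, hUU]) (by rw [hUH, hUU]) ?_
    rw [hρ, conj_mul, conj_mul, diagonal_mul_diagonal, diagonal_mul_diagonal]
    simp only [mul_comm]
  have hGG : G * G = G := conj_inj (by rw [← conj_mul, hidem])
  have hGtr : ∑ k, G.diag k = 1 := by
    rw [trace_mul_comm, ← mul_assoc, hVV, one_mul] at htr
    exact htr
  obtain ⟨j, hj⟩ := exists_eq_single_of_mul_self_of_sum_eq_one (g := G.diag) (fun k ↦ by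
    have h := congrFun₂ hGG k k
    rw [hdiag, diagonal_mul_diagonal] at h
    simpa using h) hGtr
  refine ⟨j, ?_⟩
  rw [hdiag, hj]
  ext a b
  rw [mul_apply]
  simp [mul_diagonal, Pi.single_apply, vecMulVec_apply, hV]
end
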